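/- arXiv:1209.4341 — 13 statements merged into one kernel-verified Lean document; each statement's English description precedes it below -/
import Mathlib

section
/- Let f : E₁ → E₂ be a continuous weakly open map between metric spaces with E₁ a Polish space (separable and completely metrizable). If D is a dense Gδ subset of E₂, then f⁻¹(D) is a dense Gδ subset of E₁. -/
open Set Topology

/-- A continuous map is *weakly open* if the closure of the image of every nonempty
open set has nonempty interior. -/
def WeaklyOpen {α β : Type*} [TopologicalSpace α] [TopologicalSpace β] (f : α → β) : Prop :=
  ∀ U : Set α, IsOpen U → U.Nonempty → (interior (closure (f '' U))).Nonempty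

theorem stmt1 {E₁ E₂ : Type*} [MetricSpace E₁] [MetricSpace E₂] [PolishSpace E₁]
    (f : E₁ → E₂) (hf : Continuous f) (hw : WeaklyOpen f)
    (D : Set E₂) (hDdense : Dense D) (hDgdelta : IsGδ D) :
    Dense (f ⁻¹' D) ∧ IsGδ (f ⁻¹' D) := by
  obtain ⟨V, hVo, rfl⟩ := isGδ_iff_eq_iInter_nat.1 hDgdelta
  rw [preimage_iInter]
  haveI : BaireSpace E₁ := by
    letI := TopologicalSpace.upgradeIsCompletelyMetrizable E₁
    infer_instance
  refine ⟨dense_iInter_of_isOpen (fun n => (hVo n).preimage hf) (fun n => ?_),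
    IsGδ.iInter_of_isOpen (fun n => (hVo n).preimage hf)⟩
  have hVd : Dense (V n) := hDdense.mono (iInter_subset V n)
  rw [dense_iff_inter_open]
  intro U hU hUn
  obtain ⟨y, hyW, hyV⟩ := hVd.inter_open_nonempty _ isOpen_interior (hw U hU hUn)
  obtain ⟨z, hzV, x, hxU, rfl⟩ := mem_closure_iff.1 (interior_subset hyW) (V n) (hVo n) hyV
  exact ⟨x, hxU, hzV⟩
end

section
/- Let f : E₁ → E₂ be a continuous map between metric spaces with E₁ locally compact. Then f is almost open if and only if f is weakly open. -/
open Set Topology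

/-- A continuous map is *almost open* if the image of every nonempty open set
has nonempty interior. -/
def AlmostOpen {α β : Type*} [TopologicalSpace α] [TopologicalSpace β] (f : α → β) : Prop :=
  ∀ U : Set α, IsOpen U → U.Nonempty → (interior (f '' U)).Nonempty

theorem stmt2 {E₁ E₂ : Type*} [MetricSpace E₁] [MetricSpace E₂] [LocallyCompactSpace E₁]
    (f : E₁ → E₂) (hf : Continuous f) :
    AlmostOpen f ↔ WeaklyOpen f := by
  constructor
  · intro h U hU hne
    exact (h U hU hne).mono (interior_mono subset_closure)
  · intro h U hU hne
    obtain ⟨x, hx⟩ := hne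
    obtain ⟨K, hK, hxK, hKU⟩ := exists_compact_subset hU hx
    refine (h (interior K) isOpen_interior ⟨x, hxK⟩).mono (interior_mono ?_)
    exact (closure_minimal (image_mono interior_subset)
      (hK.image hf).isClosed).trans (image_mono hKU)
end

section
/- (Variation of Domain) Let f : E₁ → E₂ be a continuous map between metric spaces, and for i = 1, 2 let Dᵢ be a dense subset of Eᵢ with f(D₁) ⊆ D₂. Then f : E₁ → E₂ is weakly open if and only if the restriction f : D₁ → D₂ (with D₁ and D₂ given the subspace topologies) is weakly open. -/
open Set Topology

/-- Variation of Domain: a continuous map between metric spaces is weakly open iff its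
restriction to dense subsets (with the subspace topologies) is weakly open. -/
theorem stmt3 {E₁ E₂ : Type*} [MetricSpace E₁] [MetricSpace E₂]
    (f : E₁ → E₂) (hf : Continuous f)
    (D₁ : Set E₁) (D₂ : Set E₂) (hD₁ : Dense D₁) (hD₂ : Dense D₂)
    (hmap : Set.MapsTo f D₁ D₂) :
    WeaklyOpen f ↔ WeaklyOpen (Set.MapsTo.restrict f D₁ D₂ hmap) := by
  have key : ∀ U : Set E₁, IsOpen U →
      closure (Set.MapsTo.restrict f D₁ D₂ hmap '' (Subtype.val ⁻¹' U)) =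
        Subtype.val ⁻¹' (closure (f '' U)) := by
    intro U hU
    rw [Topology.IsInducing.subtypeVal.closure_eq_preimage_closure_image]
    congr 1
    have h1 : (Subtype.val '' (Set.MapsTo.restrict f D₁ D₂ hmap '' (Subtype.val ⁻¹' U)) : Set E₂)
        = f '' (U ∩ D₁) := by
      ext y
      constructor
      · rintro ⟨_, ⟨x, hx, rfl⟩, rfl⟩
        exact ⟨x.1, ⟨hx, x.2⟩, rfl⟩
      · rintro ⟨x, ⟨hx, hxD⟩, rfl⟩
        exact ⟨_, ⟨⟨x, hxD⟩, hx, rfl⟩, rfl⟩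
    rw [h1]
    apply Set.Subset.antisymm
    · exact closure_mono (Set.image_mono Set.inter_subset_left)
    · apply closure_minimal _ isClosed_closure
      exact (Set.image_mono (hD₁.open_subset_closure_inter hU)).trans
        (image_closure_subset_closure_image hf)
  constructor
  · intro h V hV hne
    obtain ⟨U, hU, rfl⟩ := isOpen_induced_iff.1 hV
    obtain ⟨x, hx⟩ := hne
    have h2 := h U hU ⟨x.1, hx⟩
    obtain ⟨y, hyD, hy⟩ := hD₂.exists_mem_open isOpen_interior h2
    rw [key U hU]
    exact ⟨⟨y, hyD⟩, preimage_interior_subset_interior_preimage continuous_subtype_val hy⟩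
  · intro h U hU hne
    obtain ⟨x, hxD, hx⟩ := hD₁.exists_mem_open hU hne
    have h2 := h (Subtype.val ⁻¹' U) (hU.preimage continuous_subtype_val) ⟨⟨x, hxD⟩, hx⟩
    rw [key U hU] at h2
    obtain ⟨y, hy⟩ := h2
    obtain ⟨T, hTs, hT, hyT⟩ := mem_interior.1 hy
    obtain ⟨W, hW, rfl⟩ := isOpen_induced_iff.1 hT
    refine ⟨y.1, mem_interior.2 ⟨W, ?_, hW, hyT⟩⟩
    refine (hD₂.open_subset_closure_inter hW).trans (closure_minimal ?_ isClosed_closure)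
    rintro z ⟨hz, hzD⟩
    exact hTs (show (⟨z, hzD⟩ : D₂) ∈ Subtype.val ⁻¹' W from hz)
end

section
/- Let F : X₁ → X₂ be a closed relation between compact metric spaces. Then ONE_F is a Gδ subset of X₁, and the map f_F : ONE_F → X₂ sending each x ∈ ONE_F to the unique point of F(x) is continuous. -/
open Set Topology

/-- The image of a point under a relation `F ⊆ X₁ × X₂`. -/
def RelImage {X₁ X₂ : Type*} (F : Set (X₁ × X₂)) (x : X₁) : Set X₂ := {y | (x, y) ∈ F}

/-- `ONE F` is the set of points `x` such that `F(x)` is a singleton. -/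
def ONE {X₁ X₂ : Type*} (F : Set (X₁ × X₂)) : Set X₁ := {x | ∃ y, RelImage F x = {y}}

/-- For a closed relation `F` between compact metric spaces, `ONE F` is a Gδ set and the
map `f_F : ONE F → X₂`, sending each point to the unique point of `F(x)`, is continuous. -/
theorem stmt4 {X₁ X₂ : Type*} [MetricSpace X₁] [MetricSpace X₂]
    [CompactSpace X₁] [CompactSpace X₂]
    (F : Set (X₁ × X₂)) (hF : IsClosed F) :
    IsGδ (ONE F) ∧
    ∀ g : ONE F → X₂, (∀ x : ONE F, ((x : X₁), g x) ∈ F) → Continuous g := by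
  constructor
  · let K : ℕ → Set X₁ := fun n => Prod.fst '' {p : X₁ × (X₂ × X₂) |
      (p.1, p.2.1) ∈ F ∧ (p.1, p.2.2) ∈ F ∧ 1 / ((n : ℝ) + 1) ≤ dist p.2.1 p.2.2}
    have hK : ∀ n, IsClosed (K n) := by
      intro n
      apply isClosedMap_fst_of_compactSpace
      refine IsClosed.inter (hF.preimage (by fun_prop)) (IsClosed.inter (hF.preimage (by fun_prop)) ?_)
      exact isClosed_le (f := fun _ : X₁ × (X₂ × X₂) => 1 / ((n : ℝ) + 1))
        (g := fun p : X₁ × (X₂ × X₂) => dist p.2.1 p.2.2) (by fun_prop) (by fun_prop)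
    have hE : ONE F = Prod.fst '' F ∩ ⋂ n, (K n)ᶜ := by
      ext x
      constructor
      · rintro ⟨y, hy⟩
        have h : ∀ z, (x, z) ∈ F ↔ z = y := fun z => by
          have := Set.ext_iff.1 hy z
          simpa [RelImage] using this
        refine ⟨⟨(x, y), (h y).2 rfl, rfl⟩, ?_⟩
        rw [mem_iInter]
        rintro n ⟨⟨x', a, b⟩, ⟨ha, hb, hd⟩, rfl⟩
        simp only at ha hb hd h
        rw [(h a).1 ha, (h b).1 hb, dist_self] at hd
        have : 0 < 1 / ((n : ℝ) + 1) := by positivity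
        linarith
      · rintro ⟨⟨⟨x', y⟩, hy, rfl⟩, hx⟩
        rw [mem_iInter] at hx
        refine ⟨y, ?_⟩
        ext z
        constructor
        · intro hz
          by_contra hne
          have hpos : 0 < dist z y := dist_pos.2 hne
          obtain ⟨n, hn⟩ := exists_nat_one_div_lt hpos
          exact hx n ⟨(x', z, y), ⟨hz, hy, hn.le⟩, rfl⟩
        · rintro rfl
          exact hy
    rw [hE]
    refine IsGδ.inter (isClosedMap_fst_of_compactSpace _ hF).isGδ ?_
    exact IsGδ.iInter_of_isOpen fun n => (hK n).isOpen_compl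
  · intro g hg
    rw [continuous_iff_isClosed]
    intro C hC
    have h1 : IsClosed (Prod.fst '' (F ∩ Prod.snd ⁻¹' C)) :=
      isClosedMap_fst_of_compactSpace _ (hF.inter (hC.preimage continuous_snd))
    have h2 : g ⁻¹' C = Subtype.val ⁻¹' (Prod.fst '' (F ∩ Prod.snd ⁻¹' C)) := by
      ext x
      constructor
      · intro hx
        exact ⟨(x, g x), ⟨hg x, hx⟩, rfl⟩
      · rintro ⟨⟨x', z⟩, ⟨hz, hzC⟩, hxx⟩
        obtain ⟨y, hy⟩ := x.2
        simp only at hxx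
        subst hxx
        have e1 : z ∈ RelImage F x := hz
        have e2 : g x ∈ RelImage F x := hg x
        rw [hy, mem_singleton_iff] at e1 e2
        change g x ∈ C
        rw [e2, ← e1]
        exact hzC
    rw [h2]
    exact h1.preimage continuous_subtype_val
end

section
/- Let f : X₁ → X₂ be a continuous map between compact metric spaces. Then IN_f is a Gδ subset of X₁; a point x lies in IN_f if and only if for every open U ⊆ X₁ with x ∈ U one has f⁻¹(f(x)) ⊆ U; and f restricts to a homeomorphism from IN_f onto ONE_{f⁻¹} = {y ∈ X₂ : f⁻¹(y) is a singleton}. -/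
open Set Topology

/-- `IN f` is the set of points at which `f` is injective, i.e. `f⁻¹(f(x)) = {x}`. -/
def IN {X₁ X₂ : Type*} (f : X₁ → X₂) : Set X₁ := {x | f ⁻¹' {f x} = {x}}

theorem stmt5 {X₁ X₂ : Type*} [MetricSpace X₁] [MetricSpace X₂]
    [CompactSpace X₁] [CompactSpace X₂]
    (f : X₁ → X₂) (hf : Continuous f) :
    IsGδ (IN f) ∧
    (∀ x : X₁, x ∈ IN f ↔ ∀ U : Set X₁, IsOpen U → x ∈ U → f ⁻¹' {f x} ⊆ U) ∧
    ∃ h : IN f ≃ₜ ({y | ∃ x, f ⁻¹' {y} = {x}} : Set X₂),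
      ∀ x : IN f, (h x : X₂) = f (x : X₁) := by
  have hmem : ∀ x, x ∈ IN f ↔ ∀ z, f z = f x → z = x := by
    intro x
    constructor
    · intro h z hz
      have : z ∈ f ⁻¹' {f x} := hz
      rw [show f ⁻¹' {f x} = {x} from h] at this
      exact this
    · intro h
      show f ⁻¹' {f x} = {x}
      ext z
      exact ⟨fun hz => h z hz, fun hz => congrArg f hz⟩
  refine ⟨?_, ?_, ?_⟩
  · have key : IN f = ⋂ n : ℕ, (Prod.fst '' {p : X₁ × X₁ | f p.2 = f p.1 ∧
        1 / ((n : ℝ) + 1) ≤ dist p.2 p.1})ᶜ := by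
      ext x
      rw [hmem, mem_iInter]
      constructor
      · rintro h n ⟨⟨a, b⟩, ⟨h1, h2⟩, rfl⟩
        have hb : b = a := h b h1
        subst hb
        simp only [dist_self] at h2
        have : 0 < 1 / ((n : ℝ) + 1) := by positivity
        linarith
      · intro h z hz
        by_contra hne
        obtain ⟨n, hn⟩ := exists_nat_one_div_lt (dist_pos.2 hne)
        exact h n ⟨(x, z), ⟨hz, hn.le⟩, rfl⟩
    rw [key]
    refine IsGδ.iInter_of_isOpen fun n => ?_
    rw [isOpen_compl_iff]
    refine (IsCompact.image (IsClosed.isCompact ?_) continuous_fst).isClosed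
    refine IsClosed.inter (s₁ := {p : X₁ × X₁ | f p.2 = f p.1})
      (s₂ := {p : X₁ × X₁ | 1 / ((n : ℝ) + 1) ≤ dist p.2 p.1}) ?_ ?_
    · exact isClosed_eq (hf.comp continuous_snd) (hf.comp continuous_fst)
    · exact isClosed_le continuous_const (continuous_snd.dist continuous_fst)
  · intro x
    rw [hmem]
    constructor
    · intro h U _ hx z hz
      rw [h z hz]
      exact hx
    · intro h z hz
      by_contra hne
      exact h {z}ᶜ isOpen_compl_singleton (fun e => hne e.symm) hz rfl
  · have hpre : IN f = f ⁻¹' {y | ∃ x, f ⁻¹' {y} = {x}} := by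
      ext x
      constructor
      · intro h
        exact ⟨x, h⟩
      · rintro ⟨w, hw⟩
        have : x ∈ f ⁻¹' {f x} := rfl
        rw [hw] at this
        show f ⁻¹' {f x} = {x}
        rw [hw, show x = w from this]
    let g := ({y | ∃ x, f ⁻¹' {y} = {x}} : Set X₂).restrictPreimage f
    have hg : Function.Bijective g := by
      constructor
      · rintro ⟨a, ha⟩ ⟨b, hb⟩ hab
        rw [← hpre] at hb
        exact Subtype.ext ((hmem b).1 hb a (congrArg Subtype.val hab))
      · rintro ⟨y, w, hw⟩
        have hy : f w = y := by
          have : w ∈ f ⁻¹' {y} := by rw [hw]; rfl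
          exact this
        exact ⟨⟨w, ⟨w, by rw [hy]; exact hw⟩⟩, Subtype.ext hy⟩
    refine ⟨(Homeomorph.setCongr hpre).trans
      ((Equiv.ofBijective g hg).toHomeomorphOfContinuousClosed
        hf.restrictPreimage (hf.isClosedMap.restrictPreimage _)), fun x => rfl⟩
end

section
/- Let f : X₁ → X₂ be a continuous map between compact metric spaces. The following are equivalent: (i) f is almost one-to-one, i.e. IN_f is dense in X₁; (ii) for every nonempty open U ⊆ X₁ there exists an open W ⊆ X₂ with W ∩ f(X₁) ≠ ∅ and f⁻¹(W) ⊆ U; (iii) for every nonempty open U ⊆ X₁ the set U^f = {x ∈ X₁ : f⁻¹(f(x)) ⊆ U} is nonempty; (iv) for every open U ⊆ X₁ the set U^f is dense in U. -/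
open Set Topology

theorem stmt6 {X₁ X₂ : Type*} [MetricSpace X₁] [MetricSpace X₂]
    [CompactSpace X₁] [CompactSpace X₂]
    (f : X₁ → X₂) (hf : Continuous f) :
    ([Dense (IN f),
      ∀ U : Set X₁, IsOpen U → U.Nonempty →
        ∃ W : Set X₂, IsOpen W ∧ (W ∩ Set.range f).Nonempty ∧ f ⁻¹' W ⊆ U,
      ∀ U : Set X₁, IsOpen U → U.Nonempty → {x | f ⁻¹' {f x} ⊆ U}.Nonempty,
      ∀ U : Set X₁, IsOpen U → U ⊆ closure {x | f ⁻¹' {f x} ⊆ U}] : List Prop).TFAE := by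
  have hop : ∀ U : Set X₁, IsOpen U → IsOpen ((f '' Uᶜ)ᶜ) := fun U hU =>
    ((hU.isClosed_compl.isCompact.image hf).isClosed).isOpen_compl
  have heq : ∀ U : Set X₁, {x | f ⁻¹' {f x} ⊆ U} = f ⁻¹' ((f '' Uᶜ)ᶜ) := by
    intro U
    ext x
    constructor
    · rintro h ⟨y, hy, hxy⟩
      exact hy (h hxy)
    · intro h y hy
      by_contra hyU
      exact h ⟨y, hyU, hy⟩
  tfae_have 1 → 3 := by
    intro h U hU hne
    obtain ⟨x, hxU, hx⟩ := h.inter_open_nonempty U hU hne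
    refine ⟨x, ?_⟩
    have hx' : f ⁻¹' {f x} = {x} := hx
    show f ⁻¹' {f x} ⊆ U
    rw [hx']
    exact Set.singleton_subset_iff.2 hxU
  tfae_have 3 → 2 := by
    intro h U hU hne
    obtain ⟨x, hx⟩ := h U hU hne
    rw [heq] at hx
    refine ⟨(f '' Uᶜ)ᶜ, hop U hU, ⟨f x, hx, x, rfl⟩, ?_⟩
    intro y hy
    by_contra hyU
    exact hy ⟨y, hyU, rfl⟩
  tfae_have 2 → 4 := by
    intro h U hU x hx
    rw [mem_closure_iff]
    intro V hV hxV
    obtain ⟨W, -, ⟨_, hyW, y, rfl⟩, hWU⟩ := h (U ∩ V) (hU.inter hV) ⟨x, hx, hxV⟩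
    refine ⟨y, (hWU hyW).2, ?_⟩
    intro z hz
    have hz' : f z = f y := hz
    exact (hWU (show f z ∈ W from hz' ▸ hyW)).1
  tfae_have 4 → 1 := by
    intro h
    let G : ℕ → Set X₁ := fun n =>
      ⋃ c : X₁, {x | f ⁻¹' {f x} ⊆ Metric.ball c (1 / ((n : ℝ) + 1))}
    have hGo : ∀ n, IsOpen (G n) := fun n => isOpen_iUnion fun c => by
      rw [heq]
      exact (hop _ Metric.isOpen_ball).preimage hf
    have hGd : ∀ n, Dense (G n) := fun n x =>
      closure_mono (Set.subset_iUnion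
        (fun c : X₁ => {x | f ⁻¹' {f x} ⊆ Metric.ball c (1 / ((n : ℝ) + 1))}) x)
        (h _ Metric.isOpen_ball (Metric.mem_ball_self Nat.one_div_pos_of_nat))
    refine (dense_iInter_of_isOpen hGo hGd).mono ?_
    intro x hx
    show f ⁻¹' {f x} = {x}
    refine Set.Subset.antisymm ?_ (Set.singleton_subset_iff.2 rfl)
    intro y hy
    by_contra hne
    have hpos : 0 < dist y x := dist_pos.2 hne
    obtain ⟨n, hn⟩ := exists_nat_one_div_lt (half_pos hpos)
    obtain ⟨c, hc⟩ := Set.mem_iUnion.1 (Set.mem_iInter.1 hx n)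
    have h1 := Metric.mem_ball.1 (hc hy)
    have h2 := Metric.mem_ball.1 (hc (show x ∈ f ⁻¹' {f x} from rfl))
    have h3 := dist_triangle_right y x c
    linarith
  tfae_finish
end

section
/- Let f : X₁ → X₂ be a continuous surjection between compact metric spaces. The following are equivalent: (i) f is irreducible, i.e. the only closed subset A ⊆ X₁ with f(A) = X₂ is A = X₁; (ii) f is almost one-to-one, i.e. IN_f is dense in X₁; (iii) for every subset D ⊆ X₁, D is dense in X₁ if and only if f(D) is dense in X₂. -/
open Set Topology

theorem stmt7 {X₁ X₂ : Type*} [MetricSpace X₁] [MetricSpace X₂]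
    [CompactSpace X₁] [CompactSpace X₂]
    (f : X₁ → X₂) (hf : Continuous f) (hsurj : Function.Surjective f) :
    ([∀ A : Set X₁, IsClosed A → f '' A = Set.univ → A = Set.univ,
      Dense (IN f),
      ∀ D : Set X₁, Dense D ↔ Dense (f '' D)] : List Prop).TFAE := by
  have h12 : (∀ A : Set X₁, IsClosed A → f '' A = Set.univ → A = Set.univ) →
      Dense (IN f) := by
    intro h
    let G : ℕ → Set X₁ := fun n => ⋃₀ {U | IsOpen U ∧ ∃ V : Set X₂, U = f ⁻¹' V ∧
      ∀ a ∈ U, ∀ b ∈ U, dist a b ≤ 1 / ((n : ℝ) + 1)}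
    have hGo : ∀ n, IsOpen (G n) := fun n => isOpen_sUnion fun U hU => hU.1
    have hGd : ∀ n, Dense (G n) := by
      intro n
      rw [Metric.dense_iff]
      intro x r hr
      have hn : (0 : ℝ) < 1 / ((n : ℝ) + 1) := by positivity
      obtain ⟨s, hs0, hs⟩ : ∃ s : ℝ, 0 < s ∧ s ≤ r ∧ 2 * s ≤ 1 / ((n : ℝ) + 1) :=
        ⟨min r (1 / ((n : ℝ) + 1) / 2), lt_min hr (by linarith), min_le_left _ _, by
          have := min_le_right r (1 / ((n : ℝ) + 1) / 2)
          linarith⟩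
      have hA : IsClosed (Metric.ball x s)ᶜ := Metric.isOpen_ball.isClosed_compl
      have hne : f '' (Metric.ball x s)ᶜ ≠ Set.univ := by
        intro he
        have h1 : x ∈ (Metric.ball x s)ᶜ := by
          rw [h _ hA he]
          exact Set.mem_univ x
        exact h1 (Metric.mem_ball_self hs0)
      obtain ⟨y, hy⟩ := (Set.ne_univ_iff_exists_notMem _).1 hne
      obtain ⟨z, rfl⟩ := hsurj y
      have hsub : ∀ a ∈ f ⁻¹' (f '' (Metric.ball x s)ᶜ)ᶜ, dist a x < s := by
        intro a ha
        by_contra hc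
        exact ha ⟨a, fun hb => hc hb, rfl⟩
      have hcl : IsClosed (f '' (Metric.ball x s)ᶜ) := (hA.isCompact.image hf).isClosed
      refine ⟨z, lt_of_lt_of_le (hsub z hy) hs.1, f ⁻¹' (f '' (Metric.ball x s)ᶜ)ᶜ,
        ⟨hcl.isOpen_compl.preimage hf, _, rfl, ?_⟩, hy⟩
      intro a ha b hb
      have h1 := hsub a ha
      have h2 := hsub b hb
      have h3 := dist_triangle_right a b x
      linarith [hs.2]
    refine (dense_iInter_of_isOpen hGo hGd).mono ?_
    intro x hx
    ext y
    constructor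
    · intro hy
      have hy' : f y = f x := hy
      refine dist_le_zero.1 (le_of_forall_pos_le_add fun ε hε => ?_)
      obtain ⟨n, hn⟩ := exists_nat_one_div_lt hε
      obtain ⟨U, ⟨_, V, rfl, hd⟩, hxU⟩ := Set.mem_iInter.1 hx n
      have hyU : y ∈ f ⁻¹' V := by
        change f y ∈ V
        rw [hy']
        exact hxU
      linarith [hd y hyU x hxU]
    · rintro rfl
      rfl
  have h21 : Dense (IN f) →
      (∀ A : Set X₁, IsClosed A → f '' A = Set.univ → A = Set.univ) := by
    intro h A hA hfA
    have hs : IN f ⊆ A := by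
      intro x hx
      obtain ⟨a, ha, hax⟩ : f x ∈ f '' A := by
        rw [hfA]
        exact Set.mem_univ _
      have hx' : f ⁻¹' {f x} = {x} := hx
      have h1 : a ∈ f ⁻¹' {f x} := hax
      rw [hx'] at h1
      have h2 : a = x := h1
      exact h2 ▸ ha
    have := (h.mono hs).closure_eq
    rwa [hA.closure_eq] at this
  have h13 : (∀ A : Set X₁, IsClosed A → f '' A = Set.univ → A = Set.univ) →
      ∀ D : Set X₁, Dense D ↔ Dense (f '' D) := by
    intro h D
    refine ⟨fun hD => hsurj.denseRange.dense_image hf hD, fun hD => ?_⟩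
    rw [dense_iff_closure_eq]
    refine h _ isClosed_closure ?_
    have hcl : IsClosed (f '' closure D) := (isClosed_closure.isCompact.image hf).isClosed
    rw [← hcl.closure_eq]
    exact (hD.mono (Set.image_mono subset_closure)).closure_eq
  have h31 : (∀ D : Set X₁, Dense D ↔ Dense (f '' D)) →
      (∀ A : Set X₁, IsClosed A → f '' A = Set.univ → A = Set.univ) := by
    intro h A hA hfA
    have hd : Dense A := (h A).2 (by
      rw [hfA]
      exact dense_univ)
    have := hd.closure_eq
    rwa [hA.closure_eq] at this
  tfae_have 1 → 2 := h12
  tfae_have 2 → 1 := h21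
  tfae_have 1 → 3 := h13
  tfae_have 3 → 1 := h31
  tfae_finish
end

section
/- If f : X₁ → X₂ is an irreducible continuous surjection between compact metric spaces, then f is almost open and IN_f = OPEN_f, where OPEN_f is the set of points at which f is open. -/
open Set Topology

/-- `OPENat f` is the set of points at which `f` is open. -/
def OPENat {α β : Type*} [TopologicalSpace α] [TopologicalSpace β] (f : α → β) : Set α :=
  {x | ∀ U : Set α, IsOpen U → x ∈ U → f x ∈ interior (f '' U)}

theorem stmt8 {X₁ X₂ : Type*} [MetricSpace X₁] [MetricSpace X₂]
    [CompactSpace X₁] [CompactSpace X₂]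
    (f : X₁ → X₂) (hf : Continuous f) (hsurj : Function.Surjective f)
    (hirr : ∀ A : Set X₁, IsClosed A → f '' A = Set.univ → A = Set.univ) :
    AlmostOpen f ∧ IN f = OPENat f := by
  have hV : ∀ U : Set X₁, IsOpen U → IsOpen (f '' Uᶜ)ᶜ := fun U hU =>
    (hU.isClosed_compl.isCompact.image hf).isClosed.isOpen_compl
  have hsub : ∀ U : Set X₁, (f '' Uᶜ)ᶜ ⊆ f '' U := by
    intro U z hz
    obtain ⟨w, rfl⟩ := hsurj z
    by_contra h
    exact hz ⟨w, fun hw => h ⟨w, hw, rfl⟩, rfl⟩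
  have hne : ∀ U : Set X₁, IsOpen U → U.Nonempty → (f '' Uᶜ)ᶜ.Nonempty := by
    intro U hU hn
    by_contra h
    rw [Set.not_nonempty_iff_eq_empty, Set.compl_empty_iff] at h
    have h2 := hirr _ hU.isClosed_compl h
    rw [Set.compl_univ_iff] at h2
    exact hn.ne_empty h2
  refine ⟨fun U hU hn => (hne U hU hn).mono (interior_maximal (hsub U) (hV U hU)), ?_⟩
  apply Set.Subset.antisymm
  · intro x hx U hU hxU
    refine interior_maximal (hsub U) (hV U hU) ?_
    rintro ⟨y, hy, hyx⟩
    have h1 : f ⁻¹' {f x} = {x} := hx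
    have h2 : y ∈ f ⁻¹' {f x} := hyx
    rw [h1] at h2
    have h3 : y = x := h2
    exact hy (h3 ▸ hxU)
  · intro x hx
    show f ⁻¹' {f x} = {x}
    apply Set.Subset.antisymm
    · intro y hy
      have hyx : f y = f x := hy
      by_contra hn
      have hn' : x ≠ y := fun h => hn h.symm
      obtain ⟨U, W, hU, hW, hxU, hyW, hd⟩ := t2_separation hn'
      have h1 := hx U hU hxU
      obtain ⟨z, hz⟩ := hne (W ∩ f ⁻¹' interior (f '' U))
        (hW.inter (isOpen_interior.preimage hf))
        ⟨y, hyW, by rw [Set.mem_preimage, hyx]; exact h1⟩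
      obtain ⟨w, hw, hwz⟩ := hsub _ hz
      obtain ⟨u, hu, huw⟩ := interior_subset hw.2
      exact hz ⟨u, fun h => Set.disjoint_left.mp hd hu h.1, huw.trans hwz⟩
    · rintro y rfl
      rfl
end

section
/- Let f : X₁ → X₂ be a continuous surjection between compact metric spaces. The following are equivalent: (i) X₁ contains a unique closed subset which is minimal for f; (ii) f(IN_f) is dense in X₂. When these conditions hold, the unique minimal set is the closure of IN_f in X₁. -/
open Set Topology

/-- `A` is a minimal set for the surjection `f` : it is closed, maps onto the codomain,
and no proper closed subset of it maps onto the codomain. -/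
def IsMinFor {X₁ X₂ : Type*} [TopologicalSpace X₁] [TopologicalSpace X₂]
    (f : X₁ → X₂) (A : Set X₁) : Prop :=
  IsClosed A ∧ f '' A = Set.univ ∧
    ∀ B ⊆ A, IsClosed B → f '' B = Set.univ → B = A

lemma aux_exists_min {X₁ X₂ : Type*} [MetricSpace X₁] [MetricSpace X₂]
    [CompactSpace X₁] [CompactSpace X₂]
    (f : X₁ → X₂) (hf : Continuous f) (C : Set X₁) (hC : IsClosed C) (hs : f '' C = Set.univ) :
    ∃ A ⊆ C, IsMinFor f A := by
  obtain ⟨A, hAC, hA⟩ := zorn_superset_nonempty {B : Set X₁ | IsClosed B ∧ f '' B = Set.univ}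
    (by
      intro c hc hchain hne
      refine ⟨⋂₀ c, ⟨isClosed_sInter fun t ht => (hc ht).1, ?_⟩, fun s hs => Set.sInter_subset_of_mem hs⟩
      rw [Set.eq_univ_iff_forall]
      intro y
      have : Nonempty c := hne.to_subtype
      have hcl : ∀ i : c, IsClosed ((i : Set X₁) ∩ f ⁻¹' {y}) := fun i =>
        (hc i.2).1.inter (isClosed_singleton.preimage hf)
      obtain ⟨x, hx⟩ := IsCompact.nonempty_iInter_of_directed_nonempty_isCompact_isClosed
        (fun i : c => (i : Set X₁) ∩ f ⁻¹' {y})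
        (by
          intro i j
          rcases hchain.total i.2 j.2 with h | h
          · exact ⟨i, subset_rfl, Set.inter_subset_inter_left _ h⟩
          · exact ⟨j, Set.inter_subset_inter_left _ h, subset_rfl⟩)
        (by
          intro i
          obtain ⟨x, hx, hxy⟩ : y ∈ f '' (i : Set X₁) := by rw [(hc i.2).2]; trivial
          exact ⟨x, hx, hxy⟩)
        (fun i => (hcl i).isCompact) hcl
      rw [Set.mem_iInter] at hx
      exact ⟨x, fun t ht => (hx ⟨t, ht⟩).1, (hx (Classical.arbitrary c)).2⟩)
    C ⟨hC, hs⟩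
  exact ⟨A, hAC, hA.prop.1, hA.prop.2, fun B hB hBc hBs =>
    hB.antisymm (hA.le_of_le ⟨hBc, hBs⟩ hB)⟩

lemma aux_IN_subset {X₁ X₂ : Type*} (f : X₁ → X₂) (A : Set X₁) (hs : f '' A = Set.univ) :
    IN f ⊆ A := by
  intro x hx
  obtain ⟨z, hz, hzx⟩ : f x ∈ f '' A := by rw [hs]; trivial
  have h1 : z ∈ f ⁻¹' {f x} := hzx
  have h2 : f ⁻¹' {f x} = {x} := hx
  rw [h2] at h1
  rw [← show z = x from h1]; exact hz

lemma aux_dense {X₁ X₂ : Type*} [MetricSpace X₁] [MetricSpace X₂]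
    [CompactSpace X₁] [CompactSpace X₂]
    (f : X₁ → X₂) (hf : Continuous f) (hsurj : Function.Surjective f)
    (A : Set X₁) (hA : f '' A = Set.univ)
    (hall : ∀ C : Set X₁, IsClosed C → f '' C = Set.univ → A ⊆ C) : Dense (f '' IN f) := by
  let U : ℕ → Set X₂ := fun n => ⋃ x : X₁, (f '' (Metric.ball x (1 / ((n : ℝ) + 1)))ᶜ)ᶜ
  have hUo : ∀ n, IsOpen (U n) := fun n => isOpen_iUnion fun x =>
    (hf.isClosedMap _ Metric.isOpen_ball.isClosed_compl).isOpen_compl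
  have hUd : ∀ n, Dense (U n) := by
    intro n
    rw [dense_iff_inter_open]
    rintro V hV ⟨y, hy⟩
    by_contra hne
    obtain ⟨x, hx, rfl⟩ : y ∈ f '' A := by rw [hA]; trivial
    have hpos : (0 : ℝ) < 1 / ((n : ℝ) + 1) := by positivity
    have := hall (Metric.ball x (1 / ((n : ℝ) + 1)) ∩ f ⁻¹' V)ᶜ
      (Metric.isOpen_ball.inter (hV.preimage hf)).isClosed_compl ?_ hx
    · exact this ⟨Metric.mem_ball_self hpos, hy⟩
    · rw [Set.eq_univ_iff_forall]
      intro z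
      by_cases hz : z ∈ V
      · have hzU : z ∉ U n := fun h => hne ⟨z, hz, h⟩
        simp only [U, Set.mem_iUnion, not_exists, Set.notMem_compl_iff] at hzU
        obtain ⟨w, hw, rfl⟩ := hzU x
        exact ⟨w, fun h => hw h.1, rfl⟩
      · obtain ⟨w, rfl⟩ := hsurj z
        exact ⟨w, fun h => hz h.2, rfl⟩
  refine (dense_iInter_of_isOpen hUo hUd).mono ?_
  intro y hy
  rw [Set.mem_iInter] at hy
  obtain ⟨x, rfl⟩ := hsurj y
  refine ⟨x, ?_, rfl⟩
  ext z
  constructor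
  · intro hz
    have hz' : f z = f x := hz
    by_contra hne
    have hd : 0 < dist z x := dist_pos.mpr hne
    obtain ⟨n, hn⟩ := exists_nat_one_div_lt (half_pos hd)
    obtain ⟨w, hw⟩ := Set.mem_iUnion.mp (hy n)
    have key : ∀ t, f t = f x → dist t w < 1 / ((n : ℝ) + 1) := by
      intro t ht
      by_contra h
      exact hw ⟨t, h, ht⟩
    have h1 := key z hz'
    have h2 := key x rfl
    have h3 := dist_triangle_right z x w
    linarith
  · intro hz
    rw [show z = x from hz]; rfl

theorem stmt10 {X₁ X₂ : Type*} [MetricSpace X₁] [MetricSpace X₂]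
    [CompactSpace X₁] [CompactSpace X₂]
    (f : X₁ → X₂) (hf : Continuous f) (hsurj : Function.Surjective f) :
    ((∃! A : Set X₁, IsMinFor f A) ↔ Dense (f '' IN f)) ∧
    (Dense (f '' IN f) →
      IsMinFor f (closure (IN f)) ∧ ∀ A : Set X₁, IsMinFor f A → A = closure (IN f)) := by
  have main : Dense (f '' IN f) →
      IsMinFor f (closure (IN f)) ∧ ∀ A : Set X₁, IsMinFor f A → A = closure (IN f) := by
    intro hd
    have hs : f '' closure (IN f) = Set.univ := by
      rw [Set.eq_univ_iff_forall]
      intro y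
      exact closure_minimal (Set.image_mono subset_closure)
        (hf.isClosedMap _ isClosed_closure) (hd y)
    refine ⟨⟨isClosed_closure, hs, fun B hB hBc hBs =>
      hB.antisymm (closure_minimal (aux_IN_subset f B hBs) hBc)⟩, fun A hA => ?_⟩
    exact (hA.2.2 _ (closure_minimal (aux_IN_subset f A hA.2.1) hA.1) isClosed_closure hs).symm
  refine ⟨⟨?_, fun hd => ⟨_, (main hd).1, (main hd).2⟩⟩, main⟩
  rintro ⟨A, hA, huniq⟩
  refine aux_dense f hf hsurj A hA.2.1 fun C hC hCs => ?_
  obtain ⟨A', hA', hm⟩ := aux_exists_min f hf C hC hCs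
  rw [← huniq A' hm]; exact hA'
end

section
/- If f : X₁ → X₂ is a continuous surjection between compact metric spaces, then the set {y ∈ X₂ : f⁻¹(y) ⊆ OPEN_f} is a dense Gδ subset of X₂. -/
open Set Topology

theorem stmt11 {X₁ X₂ : Type*} [MetricSpace X₁] [MetricSpace X₂]
    [CompactSpace X₁] [CompactSpace X₂]
    (f : X₁ → X₂) (hf : Continuous f) (hsurj : Function.Surjective f) :
    IsGδ {y : X₂ | f ⁻¹' {y} ⊆ OPENat f} ∧ Dense {y : X₂ | f ⁻¹' {y} ⊆ OPENat f} := by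
  constructor
  · let V : ℕ → Set X₁ := fun n => ⋃ U ∈ {U : Set X₁ | IsOpen U ∧
      ∀ a ∈ U, ∀ b ∈ U, dist a b < 1 / ((n : ℝ) + 1)}, U ∩ f ⁻¹' (interior (f '' U))
    have hV : ∀ n, IsOpen (V n) := fun n =>
      isOpen_biUnion fun U hU => hU.1.inter (isOpen_interior.preimage hf)
    have hEq : {y : X₂ | f ⁻¹' {y} ⊆ OPENat f} = ⋂ n, (f '' (V n)ᶜ)ᶜ := by
      ext y
      simp only [mem_iInter, mem_compl_iff, mem_setOf_eq]
      constructor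
      · rintro h n ⟨x, hx, rfl⟩
        apply hx
        have hxo := h (show x ∈ f ⁻¹' {f x} from rfl)
        have hpos : (0 : ℝ) < 1 / ((n : ℝ) + 1) / 2 := by positivity
        refine mem_biUnion (x := Metric.ball x (1 / ((n : ℝ) + 1) / 2))
          ⟨Metric.isOpen_ball, ?_⟩ ⟨Metric.mem_ball_self hpos,
            hxo _ Metric.isOpen_ball (Metric.mem_ball_self hpos)⟩
        intro a ha b hb
        have := dist_triangle_right a b x
        rw [Metric.mem_ball] at ha hb
        linarith
      · intro h x hx U hU hxU
        have hx' : f x = y := hx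
        obtain ⟨ε, hε, hb⟩ := Metric.isOpen_iff.1 hU x hxU
        obtain ⟨n, hn⟩ := exists_nat_one_div_lt hε
        have hxV : x ∈ V n := by
          by_contra hc
          exact h n ⟨x, hc, hx'⟩
        obtain ⟨W, hW, hxW, hfW⟩ := mem_iUnion₂.1 hxV
        refine interior_mono (image_mono ?_) hfW
        intro a ha
        exact hb (Metric.mem_ball.2 ((hW.2 a ha x hxW).trans hn))
    rw [hEq]
    refine IsGδ.iInter fun n => IsOpen.isGδ ?_
    exact (hf.isClosedMap _ (hV n).isClosed_compl).isOpen_compl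
  · let B := TopologicalSpace.countableBasis X₁
    have hB : TopologicalSpace.IsTopologicalBasis B := TopologicalSpace.isBasis_countableBasis X₁
    have hD : Dense (⋂ b ∈ B, (frontier (f '' closure b))ᶜ) := by
      refine dense_biInter_of_isOpen (fun b _ => isClosed_frontier.isOpen_compl)
        (TopologicalSpace.countable_countableBasis X₁) (fun b _ => ?_)
      exact interior_eq_empty_iff_dense_compl.1
        (interior_frontier (hf.isClosedMap _ isClosed_closure))
    refine hD.mono ?_
    intro y hy x hx U hU hxU
    have hx' : f x = y := hx
    obtain ⟨b, hb, hxb, hbU⟩ := hB.exists_closure_subset (hU.mem_nhds hxU)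
    have h1 := mem_iInter₂.1 hy b hb
    rw [(hf.isClosedMap _ isClosed_closure).frontier_eq] at h1
    rw [hx']
    by_contra hc
    exact h1 ⟨⟨x, subset_closure hxb, hx'⟩, fun h => hc (interior_mono (image_mono hbU) h)⟩
end

section
/- If X is a nonempty compact metric space without isolated points, then there exists an irreducible continuous surjection f : C → X, where C is the Cantor set (the space {0,1}^ℕ with the product topology). If in addition X is connected, then IN_f has empty interior in C; that is, C \ IN_f is dense in C. -/
open Set Topology

noncomputable def brK (S : Set (ℕ → Bool)) : ℕ := sInf {k | ∃ y ∈ S, ∃ z ∈ S, y k ≠ z k}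

noncomputable def brA (E : Set (ℕ → Bool)) (x : ℕ → Bool) : ℕ → Set (ℕ → Bool)
  | 0 => E
  | n + 1 => {y ∈ brA E x n | y (brK (brA E x n)) = x n}

noncomputable def brB (E : Set (ℕ → Bool)) (x : ℕ → Bool) : ℕ → Set (ℕ → Bool)
  | 0 => E
  | n + 1 => {y ∈ brB E x n | y (brK (brB E x n)) = x (brK (brB E x n))}

theorem brA_congr (E : Set (ℕ → Bool)) (x x' : ℕ → Bool) (n : ℕ) (h : ∀ i < n, x i = x' i) :
    brA E x n = brA E x' n := by
  induction n with
  | zero => rfl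
  | succ n ih =>
    have := ih (fun i hi => h i (by omega))
    simp only [brA, this, h n (by omega)]

theorem brK_spec (S : Set (ℕ → Bool)) (h : ∃ y ∈ S, ∃ z ∈ S, y ≠ z) :
    (∃ y ∈ S, ∃ z ∈ S, y (brK S) ≠ z (brK S)) ∧ ∀ k < brK S, ∀ y ∈ S, ∀ z ∈ S, y k = z k := by
  constructor
  · have : {k | ∃ y ∈ S, ∃ z ∈ S, y k ≠ z k}.Nonempty := by
      obtain ⟨y, hy, z, hz, hne⟩ := h
      obtain ⟨k, hk⟩ := Function.ne_iff.1 hne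
      exact ⟨k, y, hy, z, hz, hk⟩
    exact Nat.sInf_mem this
  · intro k hk y hy z hz
    by_contra hne
    exact Nat.notMem_of_lt_sInf hk ⟨y, hy, z, hz, hne⟩

theorem brA_inv (E : Set (ℕ → Bool)) (hc : IsClosed E) (hn : E.Nonempty)
    (hE : ∀ U : Set (ℕ → Bool), IsOpen U → (E ∩ U).Nonempty →
      ∃ y ∈ E ∩ U, ∃ z ∈ E ∩ U, y ≠ z) (x : ℕ → Bool) (n : ℕ) :
    (∃ U, IsOpen U ∧ brA E x n = E ∩ U) ∧ IsClosed (brA E x n) ∧ (brA E x n).Nonempty ∧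
      ∀ i < n, ∀ y ∈ brA E x n, ∀ z ∈ brA E x n, y i = z i := by
  induction n with
  | zero => exact ⟨⟨univ, isOpen_univ, by simp [brA]⟩, hc, hn, by simp⟩
  | succ n ih =>
    obtain ⟨⟨U, hU, hAU⟩, hcl, hne, hag⟩ := ih
    have h2 : ∃ y ∈ brA E x n, ∃ z ∈ brA E x n, y ≠ z := by
      rw [hAU] at hne ⊢; exact hE U hU hne
    obtain ⟨⟨y, hy, z, hz, hyz⟩, hlt⟩ := brK_spec _ h2
    have hcont : Continuous (fun y : ℕ → Bool => y (brK (brA E x n))) := continuous_apply _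
    have heq : brA E x (n+1) = brA E x n ∩
      ((fun y : ℕ → Bool => y (brK (brA E x n))) ⁻¹' {x n}) := rfl
    have hkn : n ≤ brK (brA E x n) := by
      by_contra hlt'
      exact hyz (hag _ (by omega) y hy z hz)
    refine ⟨⟨U ∩ ((fun y : ℕ → Bool => y (brK (brA E x n))) ⁻¹' {x n}),
      hU.inter ((isOpen_discrete _).preimage hcont), ?_⟩, ?_, ?_, ?_⟩
    · rw [heq, ← inter_assoc, ← hAU]
    · rw [heq]; exact hcl.inter ((isClosed_discrete _).preimage hcont)
    · by_cases h : y (brK (brA E x n)) = x n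
      · exact ⟨y, hy, h⟩
      · refine ⟨z, hz, ?_⟩
        revert h hyz
        generalize y (brK (brA E x n)) = a
        generalize z (brK (brA E x n)) = b
        generalize x n = c
        revert a b c; decide
    · intro i hi u hu v hv
      by_cases h : i < brK (brA E x n)
      · exact hlt i h u hu.1 v hv.1
      · have : i = brK (brA E x n) := by omega
        rw [this]; exact hu.2.trans hv.2.symm

theorem exists_cantor_param (E : Set (ℕ → Bool)) (hc : IsClosed E) (hn : E.Nonempty)
    (hE : ∀ U : Set (ℕ → Bool), IsOpen U → (E ∩ U).Nonempty →
      ∃ y ∈ E ∩ U, ∃ z ∈ E ∩ U, y ≠ z) :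
    ∃ h : (ℕ → Bool) → (ℕ → Bool), Continuous h ∧ Function.Injective h ∧ range h = E := by
  have inv := brA_inv E hc hn hE
  have hex : ∀ x, (⋂ n, brA E x n).Nonempty := fun x =>
    IsCompact.nonempty_iInter_of_sequence_nonempty_isCompact_isClosed _
      (fun n y hy => hy.1) (fun n => (inv x n).2.2.1) hc.isCompact (fun n => (inv x n).2.1)
  choose h hh using hex
  have hh' : ∀ x n, h x ∈ brA E x n := fun x n => mem_iInter.1 (hh x) n
  refine ⟨h, ?_, ?_, ?_⟩
  · refine continuous_pi fun i => ?_
    refine IsLocallyConstant.continuous ?_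
    rw [IsLocallyConstant.iff_eventually_eq]
    intro x
    have : ∀ᶠ x' in 𝓝 x, ∀ j ∈ Finset.range (i+1), x' j = x j := by
      rw [Filter.eventually_all_finset]
      intro j _
      exact (continuous_apply j).continuousAt.eventually
        (show ∀ᶠ b in 𝓝 (x j), b = x j by simp [nhds_discrete])
    filter_upwards [this] with x' hx'
    have e : brA E x' (i+1) = brA E x (i+1) :=
      brA_congr _ _ _ _ (fun j hj => hx' j (Finset.mem_range.2 hj))
    exact (inv x (i+1)).2.2.2 i (by omega) _ (e ▸ hh' x' (i+1)) _ (hh' x (i+1))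
  · intro x x' hxx
    have : ∀ n, ∀ i < n, x i = x' i := by
      intro n
      induction n with
      | zero => simp
      | succ n ih =>
        intro i hi
        rcases Nat.lt_succ_iff_lt_or_eq.1 hi with h1 | rfl
        · exact ih i h1
        · have e := brA_congr E x x' i ih
          have a := (hh' x (i+1)).2
          have b := (hh' x' (i+1)).2
          rw [← a, ← b, hxx, e]
    exact funext fun i => this (i+1) i (by omega)
  · ext y
    constructor
    · rintro ⟨x, rfl⟩; exact hh' x 0
    · intro hy
      let x : ℕ → Bool := fun n => y (brK (brB E y n))
      have e : ∀ n, brA E x n = brB E y n := by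
        intro n
        induction n with
        | zero => rfl
        | succ n ih => simp only [brA, brB, ih, x]
      have hyB : ∀ n, y ∈ brB E y n := by
        intro n
        induction n with
        | zero => exact hy
        | succ n ih => exact ⟨ih, rfl⟩
      refine ⟨x, funext fun i => ?_⟩
      exact (inv x (i+1)).2.2.2 i (by omega) _ (hh' x (i+1)) _ (e (i+1) ▸ hyB (i+1))

theorem IN_part {X : Type*} [MetricSpace X] [ConnectedSpace X] (f : (ℕ → Bool) → X)
    (hf : Continuous f) (hs : Function.Surjective f) : interior (IN f) = ∅ := by
  by_contra hne
  obtain ⟨x, hx⟩ := nonempty_iff_ne_empty.2 hne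
  let y : ℕ → Bool := fun n => !(x n)
  have hxy : x ≠ y := fun h => by simpa [y] using congrFun h 0
  obtain ⟨V, hV, hxV, hVs⟩ := compact_exists_isClopen_in_isOpen
    (isOpen_interior.inter (isOpen_compl_singleton (x := y))) (⟨hx, hxy⟩ : x ∈ interior (IN f) ∩ {y}ᶜ)
  have hyV : y ∉ V := fun h => (hVs h).2 rfl
  have hcomp : (f '' V)ᶜ = f '' Vᶜ := by
    ext p
    constructor
    · intro hp
      obtain ⟨a, rfl⟩ := hs p
      exact ⟨a, fun ha => hp ⟨a, ha, rfl⟩, rfl⟩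
    · rintro ⟨a, ha, rfl⟩ ⟨b, hb, hab⟩
      have : f ⁻¹' {f b} = {b} := by
        have h3 : b ∈ IN f := interior_subset (hVs hb).1
        exact h3
      have h2 : a ∈ f ⁻¹' {f b} := hab.symm
      rw [this] at h2
      exact ha (h2 ▸ hb)
  have hcl : IsClopen (f '' V) := by
    refine ⟨(hV.1.isCompact.image hf).isClosed, ?_⟩
    rw [← isClosed_compl_iff, hcomp]
    exact (hV.compl.1.isCompact.image hf).isClosed
  rcases isClopen_iff.1 hcl with h | h
  · exact (h ▸ mem_image_of_mem f hxV : f x ∈ (∅ : Set X))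
  · have : f y ∈ (f '' V)ᶜ := hcomp ▸ mem_image_of_mem f hyV
    rw [h] at this
    exact this trivial

theorem exists_min_closed {X : Type*} [MetricSpace X] (g : (ℕ → Bool) → X)
    (hg : Continuous g) (hgs : Function.Surjective g) :
    ∃ E : Set (ℕ → Bool), IsClosed E ∧ g '' E = univ ∧
      ∀ F ⊆ E, IsClosed F → g '' F = univ → F = E := by
  obtain ⟨E, hE⟩ := zorn_superset {E : Set (ℕ → Bool) | IsClosed E ∧ g '' E = univ} (by
    intro C hC hch
    rcases C.eq_empty_or_nonempty with rfl | hCn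
    · exact ⟨univ, ⟨isClosed_univ, by rw [image_univ, hgs.range_eq]⟩, by simp⟩
    refine ⟨⋂₀ C, ⟨isClosed_sInter fun c hc => (hC hc).1, ?_⟩, fun c hc => sInter_subset_of_mem hc⟩
    refine eq_univ_of_forall fun p => ?_
    have hpc : IsClosed (g ⁻¹' {p}) := isClosed_singleton.preimage hg
    have : Nonempty C := hCn.to_subtype
    have hne : (⋂ c : C, (c : Set (ℕ → Bool)) ∩ g ⁻¹' {p}).Nonempty := by
      apply IsCompact.nonempty_iInter_of_directed_nonempty_isCompact_isClosed
      · intro c d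
        rcases hch.total c.2 d.2 with h | h
        · exact ⟨c, subset_rfl, inter_subset_inter_left _ h⟩
        · exact ⟨d, inter_subset_inter_left _ h, subset_rfl⟩
      · intro c
        obtain ⟨z, hz, hzp⟩ := ((hC c.2).2 ▸ mem_univ p : p ∈ g '' (c : Set (ℕ → Bool)))
        exact ⟨z, hz, hzp⟩
      · exact fun c => ((hC c.2).1.inter hpc).isCompact
      · exact fun c => (hC c.2).1.inter hpc
    obtain ⟨z, hz⟩ := hne
    rw [mem_iInter] at hz
    exact ⟨z, fun c hc => (hz ⟨c, hc⟩).1, (hz (Classical.arbitrary C)).2⟩)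
  exact ⟨E, hE.prop.1, hE.prop.2, fun F hF hFc hFi =>
    hF.antisymm (hE.le_of_le ⟨hFc, hFi⟩ hF)⟩

/-- Every nonempty compact metric space without isolated points admits an irreducible
continuous surjection from the Cantor set `{0,1}^ℕ`; if moreover the space is connected,
then `IN f` has empty interior, i.e. its complement is dense. -/
theorem stmt12 {X : Type*} [MetricSpace X] [CompactSpace X] [Nonempty X]
    (hX : ∀ x : X, ¬ IsOpen ({x} : Set X)) :
    ∃ f : (ℕ → Bool) → X, Continuous f ∧ Function.Surjective f ∧
      (∀ A : Set (ℕ → Bool), IsClosed A → f '' A = Set.univ → A = Set.univ) ∧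
      (ConnectedSpace X → interior (IN f) = ∅ ∧ Dense (IN f)ᶜ) := by
  obtain ⟨g, hg, hgs⟩ := exists_nat_bool_continuous_surjective_of_compact X
  obtain ⟨E, hEcl, hEi, hmin⟩ := exists_min_closed g hg hgs
  have hEn : E.Nonempty := by
    rw [← image_nonempty (f := g), hEi]; exact univ_nonempty
  obtain ⟨h, hc, hinj, hr⟩ := exists_cantor_param E hEcl hEn (by
    rintro U hU ⟨y, hy⟩
    by_contra! hcon
    have hsing : ∀ z ∈ E ∩ U, z = y := fun z hz => (hcon y hy z hz).symm
    have hFc : IsClosed (E \ U) := hEcl.sdiff hU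
    have hne : g '' (E \ U) ≠ univ := fun h =>
      ((hmin _ sdiff_subset hFc h).symm.subset hy.1).2 hy.2
    apply hX (g y)
    have : (g '' (E \ U))ᶜ = {g y} := by
      have hsub : (g '' (E \ U))ᶜ ⊆ {g y} := by
        intro p hp
        obtain ⟨z, hz, rfl⟩ := hEi ▸ mem_univ p
        by_cases hzU : z ∈ U
        · rw [hsing z ⟨hz, hzU⟩]; rfl
        · exact (hp ⟨z, ⟨hz, hzU⟩, rfl⟩).elim
      rcases subset_singleton_iff_eq.1 hsub with h | h
      · exact (hne (compl_empty_iff.1 h)).elim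
      · exact h
    rw [← this]
    exact (hFc.isCompact.image hg).isClosed.isOpen_compl)
  have hcont : Continuous (g ∘ h) := hg.comp hc
  have hsurj : Function.Surjective (g ∘ h) := by
    rw [← range_eq_univ, range_comp, hr, hEi]
  refine ⟨g ∘ h, hcont, hsurj, ?_, ?_⟩
  · intro A hA hAi
    rw [image_comp] at hAi
    have := hmin (h '' A) (hr ▸ image_subset_range h A) (hA.isCompact.image hc).isClosed hAi
    rw [← hr, ← image_univ] at this
    exact hinj.image_injective this
  · intro _
    have := IN_part _ hcont hsurj
    exact ⟨this, interior_eq_empty_iff_dense_compl.1 this⟩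
end

section
/- Let f : X₂ → X₁ be an irreducible continuous surjection between compact metric spaces, and let g : X₁ → X₂ be a selection function for the inverse relation f⁻¹, i.e. a function with f(g(y)) = y for all y ∈ X₁. Then the interior of IN_f is a dense subset of the interior of g(X₁). In particular, if IN_f has empty interior, then g(X₁) has empty interior. -/
open Set Topology

theorem stmt13 {X₁ X₂ : Type*} [MetricSpace X₁] [MetricSpace X₂]
    [CompactSpace X₁] [CompactSpace X₂]
    (f : X₂ → X₁) (hf : Continuous f) (hsurj : Function.Surjective f)
    (hirr : ∀ A : Set X₂, IsClosed A → f '' A = Set.univ → A = Set.univ)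
    (g : X₁ → X₂) (hg : ∀ y : X₁, f (g y) = y) :
    interior (IN f) ⊆ interior (Set.range g) ∧
    interior (Set.range g) ⊆ closure (interior (IN f)) ∧
    (interior (IN f) = ∅ → interior (Set.range g) = ∅) := by
  have h1 : interior (IN f) ⊆ interior (Set.range g) := by
    apply interior_mono
    intro x hx
    have hx' : f ⁻¹' {f x} = {x} := hx
    have h : g (f x) ∈ f ⁻¹' {f x} := hg (f x)
    rw [hx'] at h
    exact ⟨f x, h⟩
  have h2 : interior (Set.range g) ⊆ closure (interior (IN f)) := by
    intro x hx
    rw [mem_closure_iff]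
    intro N hN hxN
    set W := interior (Set.range g) ∩ N with hW
    have hWo : IsOpen W := isOpen_interior.inter hN
    have hne : f '' Wᶜ ≠ Set.univ := by
      intro h
      have h' := hirr _ hWo.isClosed_compl h
      have hxW : x ∈ Wᶜ := by rw [h']; trivial
      exact hxW ⟨hx, hxN⟩
    obtain ⟨y, hy⟩ := (Set.ne_univ_iff_exists_notMem _).1 hne
    have hcl : IsClosed (f '' Wᶜ) := (hWo.isClosed_compl.isCompact.image hf).isClosed
    have hUo : IsOpen (f ⁻¹' (f '' Wᶜ)ᶜ) := hcl.isOpen_compl.preimage hf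
    have hsub : ∀ z, f z ∉ f '' Wᶜ → z ∈ W := by
      intro z hz
      by_contra hc
      exact hz ⟨z, hc, rfl⟩
    obtain ⟨z, rfl⟩ := hsurj y
    refine ⟨z, (hsub z hy).2, mem_interior.2 ⟨_, ?_, hUo, hy⟩⟩
    intro a ha
    have ha' : f a ∉ f '' Wᶜ := ha
    show f ⁻¹' {f a} = {a}
    ext b
    simp only [Set.mem_preimage, Set.mem_singleton_iff]
    refine ⟨fun hb => ?_, fun hb => by rw [hb]⟩
    obtain ⟨p, rfl⟩ := interior_subset (hsub a ha').1
    obtain ⟨q, rfl⟩ := interior_subset (hsub b (hb ▸ ha')).1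
    rw [hg, hg] at hb
    rw [hb]
  refine ⟨h1, h2, fun h => ?_⟩
  rw [h, closure_empty] at h2
  exact Set.subset_empty_iff.1 h2
end

section
/- Let X₁ and X₂ be compact metric spaces. (a) If g : X₁ → X₂ is a quasi-continuous function and F is the closure of the graph of g in X₁ × X₂, then F is a minimal set for the first-coordinate projection π₁ : X₁ × X₂ → X₁ (i.e. the restriction π₁F : F → X₁ is irreducible), and g is continuous at each point of a dense subset of X₁. (b) Conversely, if F ⊆ X₁ × X₂ is a closed relation with π₁F : F → X₁ irreducible and g : X₁ → X₂ is any function with g(x) ∈ F(x) for all x ∈ X₁, then g is quasi-continuous and F is the closure of the graph of g. -/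
open Set Topology

/-- A set is *quasi-open* when it is contained in the closure of its interior. -/
def QuasiOpen {α : Type*} [TopologicalSpace α] (A : Set α) : Prop :=
  A ⊆ closure (interior A)

/-- A function is *quasi-continuous* when the preimage of every open set is quasi-open. -/
def QuasiContinuous {α β : Type*} [TopologicalSpace α] [TopologicalSpace β] (g : α → β) : Prop :=
  ∀ V : Set β, IsOpen V → QuasiOpen (g ⁻¹' V)

/-- A surjective continuous map is *irreducible* when the only closed subset of its
domain mapping onto the codomain is the whole domain. -/
def IrreducibleMap {α β : Type*} [TopologicalSpace α] [TopologicalSpace β] (f : α → β) : Prop :=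
  Function.Surjective f ∧ ∀ A : Set α, IsClosed A → f '' A = Set.univ → A = Set.univ

/-- The restriction to a relation `F ⊆ X₁ × X₂` of the first-coordinate projection. -/
def projOne {X₁ X₂ : Type*} (F : Set (X₁ × X₂)) : F → X₁ := fun p => (p : X₁ × X₂).1

theorem QuasiContinuous.exists_open {X Y : Type*} [TopologicalSpace X] [TopologicalSpace Y]
    {g : X → Y} (hg : QuasiContinuous g) {x : X} {U : Set X} {V : Set Y} (hU : IsOpen U)
    (hV : IsOpen V) (hx : x ∈ U) (hgx : g x ∈ V) :
    ∃ W : Set X, IsOpen W ∧ W.Nonempty ∧ W ⊆ U ∧ ∀ w ∈ W, g w ∈ V := by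
  have h : x ∈ closure (interior (g ⁻¹' V)) := hg V hV hgx
  refine ⟨U ∩ interior (g ⁻¹' V), hU.inter isOpen_interior, mem_closure_iff.1 h U hU hx,
    inter_subset_left, fun w hw => (interior_subset hw.2 : w ∈ g ⁻¹' V)⟩

theorem irreducible_of_qc {X Y : Type*} [MetricSpace X] [MetricSpace Y]
    {g : X → Y} (hg : QuasiContinuous g) :
    IrreducibleMap (projOne (closure {p : X × Y | p.2 = g p.1})) := by
  refine ⟨fun x => ⟨⟨(x, g x), subset_closure rfl⟩, rfl⟩, fun A hA hAu => ?_⟩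
  have hA' : IsClosed (Subtype.val '' A) := isClosed_closure.isClosedMap_subtype_val A hA
  have key : {p : X × Y | p.2 = g p.1} ⊆ Subtype.val '' A := by
    rintro ⟨x, y⟩ hy
    obtain rfl : y = g x := hy
    by_contra hn
    have hnh : (Subtype.val '' A)ᶜ ∈ 𝓝 (x, g x) := hA'.isOpen_compl.mem_nhds hn
    rw [Metric.mem_nhds_iff] at hnh
    obtain ⟨ε, hε, hb⟩ := hnh
    obtain ⟨W, hWo, ⟨w, hw⟩, hWU, hWV⟩ := hg.exists_open (x := x) (U := Metric.ball x ε)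
      (V := Metric.ball (g x) (ε / 2)) Metric.isOpen_ball Metric.isOpen_ball
      (Metric.mem_ball_self hε) (Metric.mem_ball_self (half_pos hε))
    have hwm : w ∈ projOne (closure {p : X × Y | p.2 = g p.1}) '' A := hAu ▸ mem_univ w
    obtain ⟨⟨⟨w', y⟩, hF⟩, hpA, hpw⟩ := hwm
    obtain rfl : w' = w := hpw
    have hyd : dist y (g x) < ε := by
      obtain ⟨⟨a, b⟩, ⟨haW, hb2⟩, hab⟩ := mem_closure_iff.1 hF (W ×ˢ Metric.ball y (ε / 2))
        (hWo.prod Metric.isOpen_ball) ⟨hw, Metric.mem_ball_self (half_pos hε)⟩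
      have hab' : b = g a := hab
      have h1 : dist (g a) (g x) < ε / 2 := hWV a haW
      have h2 : dist b y < ε / 2 := hb2
      rw [hab'] at h2
      have := dist_triangle_left y (g x) (g a)
      linarith
    have : (w', y) ∈ Metric.ball (x, g x) ε := by
      rw [← ball_prod_same]
      exact ⟨hWU hw, hyd⟩
    exact hb this ⟨_, hpA, rfl⟩
  have key2 := closure_minimal key hA'
  ext ⟨p, hp⟩
  simp only [mem_univ, iff_true]
  obtain ⟨q, hq, hqp⟩ := key2 hp
  convert hq
  exact hqp.symm

theorem dense_of_qc {X Y : Type*} [MetricSpace X] [MetricSpace Y] [CompactSpace X]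
    {g : X → Y} (hg : QuasiContinuous g) : Dense {x : X | ContinuousAt g x} := by
  let O : ℕ → Set X := fun n =>
    ⋃₀ {U : Set X | IsOpen U ∧ ∀ y ∈ U, ∀ z ∈ U, dist (g y) (g z) < 1 / ((n : ℝ) + 1)}
  have hO : ∀ n, IsOpen (O n) := fun n => isOpen_sUnion fun U hU => hU.1
  have hD : ∀ n, Dense (O n) := by
    intro n x
    rw [mem_closure_iff]
    intro U hU hx
    have hpos : (0 : ℝ) < 1 / ((n : ℝ) + 1) := by positivity
    obtain ⟨W, hWo, ⟨w, hw⟩, hWU, hWV⟩ := hg.exists_open (x := x) (U := U)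
      (V := Metric.ball (g x) (1 / ((n : ℝ) + 1) / 2)) hU Metric.isOpen_ball
      hx (Metric.mem_ball_self (half_pos hpos))
    refine ⟨w, hWU hw, W, ⟨hWo, fun y hy z hz => ?_⟩, hw⟩
    have h1 : dist (g y) (g x) < _ := hWV y hy
    have h2 : dist (g z) (g x) < _ := hWV z hz
    have := dist_triangle_right (g y) (g z) (g x)
    linarith
  refine (dense_iInter_of_isOpen_nat hO hD).mono fun x hx => ?_
  refine Metric.continuousAt_iff'.2 fun ε hε => ?_
  obtain ⟨n, hn⟩ := exists_nat_one_div_lt hε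
  obtain ⟨U, ⟨hUo, hU⟩, hxU⟩ := mem_iInter.1 hx n
  filter_upwards [hUo.mem_nhds hxU] with y hy
  exact (hU y hy x hxU).trans hn

theorem stmt14 {X₁ X₂ : Type*} [MetricSpace X₁] [MetricSpace X₂]
    [CompactSpace X₁] [CompactSpace X₂] :
    -- (a)
    (∀ g : X₁ → X₂, QuasiContinuous g →
      IrreducibleMap (projOne (closure {p : X₁ × X₂ | p.2 = g p.1})) ∧
      Dense {x : X₁ | ContinuousAt g x}) ∧
    -- (b)
    (∀ F : Set (X₁ × X₂), IsClosed F → IrreducibleMap (projOne F) →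
      ∀ g : X₁ → X₂, (∀ x : X₁, (x, g x) ∈ F) →
        QuasiContinuous g ∧ closure {p : X₁ × X₂ | p.2 = g p.1} = F) := by
  refine ⟨fun g hg => ⟨irreducible_of_qc hg, dense_of_qc hg⟩, fun F hF hirr g hgF => ⟨?_, ?_⟩⟩
  · intro V hV x hx
    rw [mem_closure_iff]
    intro U hU hxU
    let A : Set F := Subtype.val ⁻¹' (U ×ˢ V)ᶜ
    have hA : IsClosed A := (hU.prod hV).isClosed_compl.preimage continuous_subtype_val
    have hne : projOne F '' A ≠ Set.univ := by
      intro h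
      have h2 := hirr.2 A hA h
      have : (⟨(x, g x), hgF x⟩ : F) ∈ A := h2 ▸ mem_univ _
      exact this ⟨hxU, hx⟩
    have : CompactSpace F := isCompact_iff_compactSpace.1 hF.isCompact
    have hcont : Continuous (projOne F) := continuous_fst.comp continuous_subtype_val
    have hcl : IsClosed (projOne F '' A) := (hA.isCompact.image hcont).isClosed
    have hW : ∀ w ∈ (projOne F '' A)ᶜ, w ∈ U ∧ g w ∈ V := by
      intro w hw
      by_contra hn
      exact hw ⟨⟨(w, g w), hgF w⟩, fun h => hn h, rfl⟩
    obtain ⟨w, hw⟩ := (ne_univ_iff_exists_notMem _).1 hne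
    exact ⟨w, (hW w hw).1, mem_interior.2 ⟨_, fun z hz => (hW z hz).2, hcl.isOpen_compl, hw⟩⟩
  · apply Subset.antisymm
    · refine closure_minimal ?_ hF
      rintro ⟨x, y⟩ hy
      obtain rfl : y = g x := hy
      exact hgF x
    · intro p hp
      have h2 := hirr.2 (Subtype.val ⁻¹' closure {p : X₁ × X₂ | p.2 = g p.1})
        (isClosed_closure.preimage continuous_subtype_val)
        (eq_univ_of_forall fun x => ⟨⟨(x, g x), hgF x⟩, subset_closure rfl, rfl⟩)
      have : (⟨p, hp⟩ : F) ∈ (Subtype.val ⁻¹' closure {p : X₁ × X₂ | p.2 = g p.1} : Set F) :=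
        h2 ▸ mem_univ _
      exact this
end
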